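/- arXiv:1410.5086 — 2 statements merged into one kernel-verified Lean document; each statement's English description precedes it below -/
import Mathlib

section
/- Let (Ω,μ,T) be a weak mixing probability measure-preserving system on a metric space with its Borel σ-algebra, let α ∈ [0,1) be irrational, and let F: [0,1)×Ω → ℝ be integrable for λ×μ such that the family of functions (F(·,ω))_{ω∈Ω} is uniformly equicontinuous. Then there is a set Ω' ⊆ Ω of full μ-measure such that for all ω ∈ Ω' and all t ∈ [0,1): (1/N) ∑_{k=1}^N F({t+kα}, T^k ω) → ∫ F d(λ×μ) as N → ∞. -/
open MeasureTheory Filter Topology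

/-- A probability measure-preserving system `(Ω, μ, T)` is weak mixing if the product
system `(Ω × Ω, μ × μ, T × T)` is ergodic. -/
def WeakMixing {Ω : Type*} [MeasurableSpace Ω] (T : Ω → Ω) (μ : Measure Ω) : Prop :=
  Ergodic (Prod.map T T) (μ.prod μ)

section Birkhoff

variable {X : Type*}

/-- The running maximum of the Birkhoff sums of `f` of lengths `1, …, n + 1`. -/
def maxBirkhoffSum (R : X → X) (f : X → ℝ) : ℕ → X → ℝ
  | 0 => f
  | n + 1 => fun x => f x + max 0 (maxBirkhoffSum R f n (R x))

lemma maxBirkhoffSum_le_succ (R : X → X) (f : X → ℝ) (n : ℕ) (x : X) :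
    maxBirkhoffSum R f n x ≤ maxBirkhoffSum R f (n + 1) x := by
  induction n generalizing x with
  | zero => simp [maxBirkhoffSum]
  | succ n ih =>
    simp only [maxBirkhoffSum]
    gcongr
    exact ih _

lemma monotone_maxBirkhoffSum (R : X → X) (f : X → ℝ) (x : X) :
    Monotone fun n => maxBirkhoffSum R f n x :=
  monotone_nat_of_le_succ fun n => maxBirkhoffSum_le_succ R f n x

lemma le_maxBirkhoffSum (R : X → X) (f : X → ℝ) (n : ℕ) (x : X) :
    f x ≤ maxBirkhoffSum R f n x :=
  monotone_maxBirkhoffSum R f x (Nat.zero_le n)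

lemma birkhoffSum_le_maxBirkhoffSum (R : X → X) (f : X → ℝ) (n : ℕ) (x : X) :
    birkhoffSum R f (n + 1) x ≤ maxBirkhoffSum R f n x := by
  induction n generalizing x with
  | zero => simp [maxBirkhoffSum]
  | succ n ih =>
    rw [birkhoffSum_succ']
    simp only [maxBirkhoffSum]
    gcongr
    exact (ih _).trans (le_max_right _ _)

lemma bddAbove_maxBirkhoffSum_comp_iff (R : X → X) (f : X → ℝ) (x : X) :
    BddAbove (Set.range fun n => maxBirkhoffSum R f n (R x)) ↔
      BddAbove (Set.range fun n => maxBirkhoffSum R f n x) := by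
  constructor
  · rintro ⟨C, hC⟩
    refine ⟨f x + max 0 C, ?_⟩
    rintro _ ⟨n, rfl⟩
    refine (maxBirkhoffSum_le_succ R f n x).trans ?_
    simp only [maxBirkhoffSum]
    gcongr
    exact hC ⟨n, rfl⟩
  · rintro ⟨C, hC⟩
    refine ⟨C - f x, ?_⟩
    rintro _ ⟨n, rfl⟩
    have h : maxBirkhoffSum R f (n + 1) x ≤ C := hC ⟨n + 1, rfl⟩
    simp only [maxBirkhoffSum] at h
    have := le_max_right 0 (maxBirkhoffSum R f n (R x))
    dsimp only
    linarith

variable [MeasurableSpace X] {ν : Measure X} {R : X → X} {f : X → ℝ}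

lemma measurable_maxBirkhoffSum (hR : Measurable R) (hf : Measurable f) (n : ℕ) :
    Measurable (maxBirkhoffSum R f n) := by
  induction n with
  | zero => exact hf
  | succ n ih => exact hf.add (measurable_const.max (ih.comp hR))

lemma integrable_maxBirkhoffSum (hR : MeasurePreserving R ν ν) (hf : Integrable f ν) (n : ℕ) :
    Integrable (maxBirkhoffSum R f n) ν := by
  induction n with
  | zero => exact hf
  | succ n ih =>
    have h : Integrable (fun x => max 0 (maxBirkhoffSum R f n (R x))) ν := by
      have := (hR.integrable_comp_of_integrable ih).pos_part
      simpa only [max_comm, Function.comp_def] using this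
    exact hf.add h

lemma ae_bddAbove_maxBirkhoffSum (hR : Ergodic R ν) (hfm : Measurable f)
    (hf : Integrable f ν) (hneg : ∫ x, f x ∂ν < 0) :
    ∀ᵐ x ∂ν, BddAbove (Set.range fun n => maxBirkhoffSum R f n x) := by
  have hmp := hR.toMeasurePreserving
  have hset : MeasurableSet {x | BddAbove (Set.range fun n => maxBirkhoffSum R f n x)} :=
    measurableSet_bddAbove_range fun n => measurable_maxBirkhoffSum hR.measurable hfm n
  rcases hR.ae_mem_or_ae_notMem hset
    (Set.ext fun x => bddAbove_maxBirkhoffSum_comp_iff R f x) with h | h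
  · exact h
  exfalso
  have hint := integrable_maxBirkhoffSum hmp hf
  have hintR : ∀ n, Integrable (fun x => maxBirkhoffSum R f n (R x)) ν :=
    fun n => hmp.integrable_comp_of_integrable (hint n)
  have hRf : Integrable (fun x => f (R x)) ν := hmp.integrable_comp_of_integrable hf
  have heq : ∀ n x, maxBirkhoffSum R f (n + 1) x - maxBirkhoffSum R f n (R x) =
      f x + max (-maxBirkhoffSum R f n (R x)) 0 := by
    intro n x
    simp only [maxBirkhoffSum]
    rcases le_total 0 (maxBirkhoffSum R f n (R x)) with h0 | h0
    · rw [max_eq_right h0, max_eq_right (by linarith)]; ring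
    · rw [max_eq_left h0, max_eq_left (by linarith)]; ring
  have hnonneg : ∀ n, 0 ≤ ∫ x, (f x + max (-maxBirkhoffSum R f n (R x)) 0) ∂ν := by
    intro n
    simp_rw [← heq]
    rw [integral_sub (hint _) (hintR n)]
    have : ∫ x, maxBirkhoffSum R f n (R x) ∂ν = ∫ x, maxBirkhoffSum R f n x ∂ν := by
      rw [← integral_map (φ := R) hR.measurable.aemeasurable]
      · rw [hmp.map_eq]
      · rw [hmp.map_eq]; exact (hint n).aestronglyMeasurable
    rw [this, sub_nonneg]
    exact integral_mono (hint n) (hint (n + 1)) (maxBirkhoffSum_le_succ R f n)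
  have hlim : Tendsto (fun n => ∫ x, (f x + max (-maxBirkhoffSum R f n (R x)) 0) ∂ν) atTop
      (𝓝 (∫ x, f x ∂ν)) := by
    refine tendsto_integral_of_dominated_convergence (fun x => |f x| + |f (R x)|)
      (fun n => ?_) (hf.abs.add hRf.abs) (fun n => .of_forall fun x => ?_) ?_
    · exact (hfm.add (((measurable_maxBirkhoffSum hR.measurable hfm n).comp
        hR.measurable).neg.max measurable_const)).aestronglyMeasurable
    · have h1 := le_maxBirkhoffSum R f n (R x)
      refine (norm_add_le _ _).trans (add_le_add le_rfl ?_)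
      rw [Real.norm_eq_abs, abs_of_nonneg (le_max_right _ _)]
      exact max_le ((neg_le_neg h1).trans (neg_le_abs _)) (abs_nonneg _)
    · filter_upwards [h] with x hx
      have hx' : ¬ BddAbove (Set.range fun n => maxBirkhoffSum R f n (R x)) :=
        fun hb => hx ((bddAbove_maxBirkhoffSum_comp_iff R f x).1 hb)
      have htop := tendsto_atTop_atTop_of_monotone' (monotone_maxBirkhoffSum R f (R x)) hx'
      refine tendsto_const_nhds.congr' ?_
      filter_upwards [htop.eventually_ge_atTop 0] with n hn
      rw [max_eq_right (by linarith), add_zero]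
  exact absurd (ge_of_tendsto' hlim hnonneg) (not_le.2 hneg)

lemma ae_eventually_birkhoffSum_le [IsProbabilityMeasure ν] (hR : Ergodic R ν)
    (hfm : Measurable f) (hf : Integrable f ν) {c : ℝ} (hc : ∫ x, f x ∂ν < c) :
    ∀ᵐ x ∂ν, ∀ᶠ n : ℕ in atTop, (n : ℝ)⁻¹ * birkhoffSum R f n x < c := by
  obtain ⟨b, hb, hbc⟩ := exists_between hc
  have key := ae_bddAbove_maxBirkhoffSum hR (f := fun x => f x - b) (hfm.sub measurable_const)
    (hf.sub (integrable_const b)) (by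
      rw [integral_sub hf (integrable_const b)]; simpa using hb)
  filter_upwards [key] with x ⟨C, hC⟩
  have hlim : Tendsto (fun n : ℕ => C / (n : ℝ)) atTop (𝓝 0) :=
    tendsto_const_div_atTop_nhds_zero_nat C
  filter_upwards [hlim.eventually_lt_const (sub_pos.2 hbc), eventually_gt_atTop 0] with n hn hn0
  obtain ⟨m, rfl⟩ := Nat.exists_eq_succ_of_ne_zero hn0.ne'
  have h1 : birkhoffSum R (fun x => f x - b) (m + 1) x ≤ C :=
    (birkhoffSum_le_maxBirkhoffSum R _ m x).trans (hC ⟨m, rfl⟩)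
  have h2 : birkhoffSum R (fun x => f x - b) (m + 1) x =
      birkhoffSum R f (m + 1) x - (m + 1 : ℕ) * b := by
    simp [birkhoffSum, Finset.sum_sub_distrib]
  have hpos : (0 : ℝ) < (m + 1 : ℕ) := by positivity
  rw [Nat.succ_eq_add_one, div_lt_iff₀ hpos] at hn
  rw [Nat.succ_eq_add_one, inv_mul_lt_iff₀ hpos]
  rw [h2] at h1
  linarith

/-- Birkhoff's pointwise ergodic theorem for ergodic transformations. -/
theorem ae_tendsto_birkhoffSum [IsProbabilityMeasure ν] (hR : Ergodic R ν)
    (hf : Integrable f ν) :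
    ∀ᵐ x ∂ν, Tendsto (fun n : ℕ => (n : ℝ)⁻¹ * birkhoffSum R f n x) atTop
      (𝓝 (∫ x, f x ∂ν)) := by
  wlog hfm : Measurable f generalizing f
  · obtain ⟨g, hgm, hfg⟩ := hf.aemeasurable
    have hg := this (hf.congr hfg) hgm
    have hsum := ae_all_iff.2 fun n =>
      hR.toMeasurePreserving.quasiMeasurePreserving.birkhoffSum_ae_eq_of_ae_eq hfg n
    filter_upwards [hg, hsum] with x hx hs
    rw [integral_congr_ae hfg]
    simpa only [hs] using hx
  have hup : ∀ᵐ x ∂ν, ∀ k : ℕ, ∀ᶠ n : ℕ in atTop,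
      (n : ℝ)⁻¹ * birkhoffSum R f n x < ∫ x, f x ∂ν + 1 / ((k : ℝ) + 1) :=
    ae_all_iff.2 fun k => ae_eventually_birkhoffSum_le hR hfm hf
      (lt_add_of_pos_right _ Nat.one_div_pos_of_nat)
  have hlow : ∀ᵐ x ∂ν, ∀ k : ℕ, ∀ᶠ n : ℕ in atTop,
      (n : ℝ)⁻¹ * birkhoffSum R (-f) n x < -∫ x, f x ∂ν + 1 / ((k : ℝ) + 1) :=
    ae_all_iff.2 fun k => ae_eventually_birkhoffSum_le hR hfm.neg hf.neg (by
      simp only [Pi.neg_apply, integral_neg]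
      exact lt_add_of_pos_right _ Nat.one_div_pos_of_nat)
  filter_upwards [hup, hlow] with x hx hx'
  rw [Metric.tendsto_atTop']
  intro ε hε
  obtain ⟨k, hk⟩ := exists_nat_one_div_lt hε
  obtain ⟨N, hN⟩ := eventually_atTop.1 ((hx k).and (hx' k))
  refine ⟨N, fun n hn => ?_⟩
  obtain ⟨h1, h2⟩ := hN n hn.le
  rw [birkhoffSum_neg, mul_neg] at h2
  rw [Real.dist_eq, abs_lt]
  constructor <;> linarith

end Birkhoff

section Rotation

variable {Ω : Type*} [MeasurableSpace Ω] {T : Ω → Ω} {μ : Measure Ω}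

/-- Measurable eigenfunctions of a weak mixing system are almost everywhere constant. -/
lemma WeakMixing.ae_eq_const_of_eigenfunction [IsProbabilityMeasure μ] (hT : WeakMixing T μ)
    {g : Ω → ℂ} (hg : Measurable g) {z : ℂ} (hz : ‖z‖ = 1) (hgT : ∀ ω, g (T ω) = z * g ω) :
    ∃ c : ℂ, ∀ᵐ ω ∂μ, g ω = c := by
  have hmeas : Measurable fun p : Ω × Ω => g p.1 * starRingEnd ℂ (g p.2) :=
    (hg.comp measurable_fst).mul (Complex.continuous_conj.measurable.comp
      (hg.comp measurable_snd))
  have hinv : (fun p : Ω × Ω => g p.1 * starRingEnd ℂ (g p.2)) ∘ Prod.map T T =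
      fun p : Ω × Ω => g p.1 * starRingEnd ℂ (g p.2) := by
    funext p
    have hzz : z * starRingEnd ℂ z = 1 := by
      rw [Complex.mul_conj, Complex.normSq_eq_norm_sq, hz]; simp
    simp only [Function.comp_apply, Prod.map_fst, Prod.map_snd, hgT, map_mul]
    linear_combination (g p.1 * starRingEnd ℂ (g p.2)) * hzz
  obtain ⟨c, hc⟩ := hT.toPreErgodic.ae_eq_const_of_ae_eq_comp hmeas hinv
  have hc' : ∀ᵐ ω' ∂μ, ∀ᵐ ω ∂μ, g ω * starRingEnd ℂ (g ω') = c := by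
    have h := Measure.measurePreserving_swap (μ := μ) (ν := μ)
      |>.quasiMeasurePreserving.ae hc
    exact Measure.ae_ae_of_ae_prod h
  by_cases h0 : ∀ᵐ ω ∂μ, g ω = 0
  · exact ⟨0, h0⟩
  obtain ⟨ω', hω', hne⟩ := (hc'.and_frequently (not_eventually.1 h0)).exists
  refine ⟨c / starRingEnd ℂ (g ω'), ?_⟩
  filter_upwards [hω'] with ω hω
  rw [eq_div_iff (by simpa using hne), hω]

/-- A square-integrable function on the circle whose nonzero Fourier modes vanish is almost
everywhere constant. -/
lemma ae_eq_const_of_fourierCoeff_eq_zero {h : UnitAddCircle → ℂ}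
    (hh : MemLp h 2 AddCircle.haarAddCircle) (h0 : ∀ n : ℤ, n ≠ 0 → fourierCoeff h n = 0) :
    ∀ᵐ x ∂(AddCircle.haarAddCircle : Measure UnitAddCircle), h x = fourierCoeff h 0 := by
  have hco : ∀ n, fourierCoeff (hh.toLp h) n = fourierCoeff h n :=
    fun n => congrFun (fourierCoeff_congr_ae hh.coeFn_toLp) n
  have hs := hasSum_fourier_series_L2 (hh.toLp h)
  have hs' := hasSum_single (f := fun i => fourierCoeff (hh.toLp h) i •
    (fourierLp 2 i : Lp ℂ 2 (AddCircle.haarAddCircle : Measure UnitAddCircle))) 0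
    (fun n hn => by rw [hco, h0 n hn, zero_smul])
  have heq := hs.unique hs'
  have h1 := hh.coeFn_toLp
  rw [heq] at h1
  filter_upwards [h1, Lp.coeFn_smul (fourierCoeff (hh.toLp h) 0)
    (fourierLp 2 0 : Lp ℂ 2 (AddCircle.haarAddCircle : Measure UnitAddCircle)),
    coeFn_fourierLp (T := (1 : ℝ)) 2 0] with x hx1 hx2 hx3
  rw [← hx1, hx2, Pi.smul_apply, hx3, fourier_zero, hco, smul_eq_mul, mul_one]

lemma fourier_coe_ne_one {α : ℝ} (hα : Irrational α) {n : ℤ} (hn : n ≠ 0) :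
    fourier n (α : UnitAddCircle) ≠ 1 := by
  rw [fourier_coe_apply, Complex.ofReal_one, div_one]
  intro h
  obtain ⟨m, hm⟩ := Complex.exp_eq_one_iff.1 h
  have hpi : (2 * Real.pi * Complex.I : ℂ) ≠ 0 := Complex.two_pi_I_ne_zero
  have h1 : (n : ℂ) * α = m := by
    apply mul_right_cancel₀ hpi
    linear_combination hm
  have h2 : (n : ℝ) * α = m := by exact_mod_cast h1
  exact (hα.intCast_mul hn).ne_int m h2

/-- The product of a weak mixing system with an irrational rotation is ergodic. -/
theorem WeakMixing.ergodic_prod_rotation [IsProbabilityMeasure μ] (hT : WeakMixing T μ)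
    (hmp : MeasurePreserving T μ μ) {α : ℝ} (hα : Irrational α) :
    Ergodic (Prod.map T fun x : UnitAddCircle => x + (α : UnitAddCircle))
      (μ.prod AddCircle.haarAddCircle) := by
  refine ⟨hmp.prod (measurePreserving_add_right _ _), ⟨fun s hs hinv => ?_⟩⟩
  set f : Ω → UnitAddCircle → ℂ := fun ω x => s.indicator (fun _ => (1 : ℂ)) (ω, x) with hf
  have hfm : Measurable (Function.uncurry f) := measurable_const.indicator hs
  have hfT : ∀ ω x, f (T ω) (x + (α : UnitAddCircle)) = f ω x := by
    intro ω x
    have : (T ω, x + (α : UnitAddCircle)) ∈ s ↔ (ω, x) ∈ s := by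
      conv_rhs => rw [← hinv]
      rfl
    by_cases h : (ω, x) ∈ s
    · simp [hf, h, this.2 h]
    · simp [hf, h, mt this.1 h]
  have hL2 : ∀ ω, MemLp (f ω) 2 (AddCircle.haarAddCircle : Measure UnitAddCircle) := by
    intro ω
    refine MemLp.of_bound (hfm.comp measurable_prodMk_left).aestronglyMeasurable 1
      (.of_forall fun x => ?_)
    simp only [hf, Set.indicator]
    split_ifs <;> simp
  have hcm : ∀ n : ℤ, Measurable fun ω => fourierCoeff (f ω) n := by
    intro n
    have : StronglyMeasurable (Function.uncurry fun (ω : Ω) (x : UnitAddCircle) =>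
        fourier (-n) x • f ω x) :=
      (((fourier (-n)).continuous.measurable.comp measurable_snd).smul hfm).stronglyMeasurable
    exact this.integral_prod_right.measurable
  have hcT : ∀ (n : ℤ) ω, fourierCoeff (f (T ω)) n =
      fourier (-n) (α : UnitAddCircle) * fourierCoeff (f ω) n := by
    intro n ω
    simp only [fourierCoeff]
    rw [← integral_add_right_eq_self _ (α : UnitAddCircle), ← integral_const_mul]
    congr 1
    funext x
    rw [hfT, fourier_apply, fourier_apply, fourier_apply, smul_add, AddCircle.toCircle_add]
    simp only [Circle.coe_mul, smul_eq_mul]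
    ring
  have hz : ∀ n : ℤ, ‖fourier n (α : UnitAddCircle)‖ = 1 := fun n => by
    rw [fourier_apply]; exact Circle.norm_coe _
  have hc0 : ∀ᵐ ω ∂μ, ∀ n : ℤ, n ≠ 0 → fourierCoeff (f ω) n = 0 := by
    refine ae_all_iff.2 fun n => ?_
    by_cases hn : n = 0
    · exact .of_forall fun ω h => absurd hn h
    obtain ⟨c, hc⟩ := hT.ae_eq_const_of_eigenfunction (hcm n) (hz _) (hcT n)
    have hc2 := hmp.quasiMeasurePreserving.ae hc
    filter_upwards [hc, hc2] with ω h1 h2 _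
    rw [hcT, h1] at h2
    have h3 : (fourier (-n) (α : UnitAddCircle) - 1) * c = 0 := by linear_combination h2
    rw [h1]
    exact (mul_eq_zero.1 h3).resolve_left
      (sub_ne_zero.2 (fourier_coe_ne_one hα (neg_ne_zero.2 hn)))
  obtain ⟨c, hc⟩ := hT.ae_eq_const_of_eigenfunction (hcm 0) (hz _) (hcT 0)
  have hall : ∀ᵐ ω ∂μ, ∀ᵐ x ∂(AddCircle.haarAddCircle : Measure UnitAddCircle),
      f ω x = c := by
    filter_upwards [hc0, hc] with ω h1 h2
    rw [← h2]
    exact ae_eq_const_of_fourierCoeff_eq_zero (hL2 ω) h1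
  rw [eventuallyConst_set]
  by_cases hc1 : c = 1
  · left
    refine (Measure.ae_prod_mem_iff_ae_ae_mem hs).2 ?_
    filter_upwards [hall] with ω hω
    filter_upwards [hω] with x hx
    by_contra hn
    simp [hf, hn, hc1] at hx
  · right
    refine (Measure.ae_prod_mem_iff_ae_ae_mem hs.compl).2 ?_
    filter_upwards [hall] with ω hω
    filter_upwards [hω] with x hx hmem
    exact hc1 (by simpa [hf, hmem] using hx.symm)

lemma measurePreserving_coe_equivIco :
    MeasurePreserving (fun x : UnitAddCircle => (AddCircle.equivIco (1 : ℝ) 0 x : ℝ))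
      AddCircle.haarAddCircle (volume.restrict (Set.Ico (0 : ℝ) 1)) := by
  have hm : Measurable fun x : UnitAddCircle => (AddCircle.equivIco (1 : ℝ) 0 x : ℝ) :=
    measurable_subtype_coe.comp (AddCircle.measurableEquivIco (1 : ℝ) 0).measurable
  have hvol : (AddCircle.haarAddCircle : Measure UnitAddCircle) = volume := by
    rw [AddCircle.volume_eq_smul_haarAddCircle]; simp
  have hmk := UnitAddCircle.measurePreserving_mk 0
  rw [zero_add, ← Measure.restrict_congr_set (Ico_ae_eq_Ioc (a := (0 : ℝ)) (b := 1))] at hmk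
  refine ⟨hm, ?_⟩
  rw [hvol, ← hmk.map_eq, Measure.map_map hm hmk.measurable]
  conv_rhs => rw [← Measure.map_id (μ := volume.restrict (Set.Ico (0 : ℝ) 1))]
  refine Measure.map_congr ?_
  filter_upwards [ae_restrict_mem measurableSet_Ico] with t ht
  exact AddCircle.equivIco_coe_of_mem (by simpa using ht)

lemma WeakMixing.ergodic_fract_prod [IsProbabilityMeasure μ] (hT : WeakMixing T μ)
    (hmp : MeasurePreserving T μ μ) {α : ℝ} (hα : Irrational α) :
    Ergodic (Prod.map (fun t : ℝ => Int.fract (t + α)) T)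
      ((volume.restrict (Set.Ico (0 : ℝ) 1)).prod μ) := by
  have hg : MeasurePreserving (Prod.map (fun x : UnitAddCircle =>
      (AddCircle.equivIco (1 : ℝ) 0 x : ℝ)) (id : Ω → Ω) ∘ Prod.swap)
      (μ.prod AddCircle.haarAddCircle) ((volume.restrict (Set.Ico (0 : ℝ) 1)).prod μ) :=
    (measurePreserving_coe_equivIco.prod (.id μ)).comp Measure.measurePreserving_swap
  refine hg.ergodic_of_ergodic_semiconj (hT.ergodic_prod_rotation hmp hα)
    (((measurable_id.add_const α).fract).prodMap hmp.measurable) fun p => ?_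
  have h := AddCircle.coe_equivIco_mk_apply (p := (1 : ℝ))
    ((AddCircle.equivIco (1 : ℝ) 0 p.2 : ℝ) + α)
  rw [div_one, mul_one] at h
  refine Prod.ext ?_ rfl
  simp only [Function.comp_apply, Prod.map_fst, Prod.fst_swap, Prod.map_snd]
  rw [← h]
  change _ = ((AddCircle.equivIco (1 : ℝ) 0
    (((AddCircle.equivIco (1 : ℝ) 0 p.2 : ℝ) + α : ℝ) : UnitAddCircle)) : ℝ)
  rw [AddCircle.coe_add, AddCircle.coe_equivIco]

lemma WeakMixing.ae_ae_tendsto_average [IsProbabilityMeasure μ] (hT : WeakMixing T μ)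
    (hmp : MeasurePreserving T μ μ) {α : ℝ} (hα : Irrational α) {K : ℝ → Ω → ℝ}
    (hK : Integrable (fun p : ℝ × Ω => K p.1 p.2)
      ((volume.restrict (Set.Ico (0 : ℝ) 1)).prod μ)) :
    ∀ᵐ ω ∂μ, ∀ᵐ t ∂(volume.restrict (Set.Ico (0 : ℝ) 1)),
      Tendsto (fun N : ℕ => (N : ℝ)⁻¹ *
          ∑ k ∈ Finset.Icc 1 N, K (Int.fract (t + k * α)) (T^[k] ω))
        atTop
        (𝓝 (∫ p, K p.1 p.2 ∂((volume.restrict (Set.Ico (0 : ℝ) 1)).prod μ))) := by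
  have hprob : IsProbabilityMeasure (volume.restrict (Set.Ico (0 : ℝ) 1)) := ⟨by simp⟩
  have hR := hT.ergodic_fract_prod hmp hα
  have h := hR.toMeasurePreserving.quasiMeasurePreserving.ae (ae_tendsto_birkhoffSum hR hK)
  have hiter : ∀ (k : ℕ) (t : ℝ), (fun t : ℝ => Int.fract (t + α))^[k + 1] t =
      Int.fract (t + (k + 1 : ℕ) * α) := by
    intro k
    induction k with
    | zero => intro t; simp
    | succ k ih =>
      intro t
      rw [Function.iterate_succ_apply', ih, Int.fract_eq_fract]
      refine ⟨-⌊t + (k + 1 : ℕ) * α⌋, ?_⟩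
      have := Int.self_sub_floor (t + (k + 1 : ℕ) * α)
      push_cast at this ⊢
      linarith
  have h2 := Measure.ae_ae_of_ae_prod
    (Measure.measurePreserving_swap (μ := μ)
      (ν := volume.restrict (Set.Ico (0 : ℝ) 1)) |>.quasiMeasurePreserving.ae h)
  filter_upwards [h2] with ω hω
  filter_upwards [hω] with t ht
  refine ht.congr fun N => ?_
  congr 1
  rw [birkhoffSum, Finset.range_eq_Ico]
  change _ = ∑ k ∈ Finset.Ico (0 + 1) (N + 1), _
  rw [← Finset.sum_Ico_add' (fun k : ℕ => K (Int.fract (t + k * α)) (T^[k] ω)) 0 N 1]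
  refine Finset.sum_congr rfl fun k _ => ?_
  rw [← Function.iterate_succ_apply, Prod.map_iterate]
  simp only [Prod.swap, Prod.map_fst, Prod.map_snd, hiter, Nat.succ_eq_add_one]

end Rotation

lemma exists_oscillation_bound {Ω : Type*} {F : ℝ → Ω → ℝ}
    (hEqui : ∀ ε > 0, ∃ δ > 0, ∀ t ∈ Set.Ico (0 : ℝ) 1, ∀ t' ∈ Set.Ico (0 : ℝ) 1,
      |t - t'| < δ → ∀ ω : Ω, |F t ω - F t' ω| < ε) :
    ∃ M > 0, ∀ t ∈ Set.Ico (0 : ℝ) 1, ∀ t' ∈ Set.Ico (0 : ℝ) 1, ∀ ω : Ω,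
      |F t ω - F t' ω| ≤ M := by
  obtain ⟨δ, hδ, h⟩ := hEqui 1 one_pos
  obtain ⟨n, hn⟩ := exists_nat_one_div_lt hδ
  have hn0 : (0 : ℝ) < (n : ℝ) + 1 := by positivity
  refine ⟨n + 1, hn0, fun t ht t' ht' ω => ?_⟩
  have hmem : ∀ j : ℕ, j ≤ n + 1 → t + ((j : ℝ) / (n + 1)) * (t' - t) ∈ Set.Ico (0 : ℝ) 1 := by
    intro j hj
    have hle : (j : ℝ) / (n + 1) ≤ 1 := by
      rw [div_le_one hn0]
      exact_mod_cast hj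
    exact (convex_Ico (0 : ℝ) 1).add_smul_sub_mem ht ht'
      (t := (j : ℝ) / (n + 1)) ⟨by positivity, hle⟩
  have key : ∀ j : ℕ, j ≤ n + 1 → |F t ω - F (t + ((j : ℝ) / (n + 1)) * (t' - t)) ω| ≤ j := by
    intro j
    induction j with
    | zero => simp
    | succ j ih =>
      intro hj
      have h1 := ih (by omega)
      have hsub : t + ((j : ℝ) / (n + 1)) * (t' - t) -
          (t + (((j + 1 : ℕ) : ℝ) / (n + 1)) * (t' - t)) = (t - t') * (1 / (n + 1)) := by
        push_cast
        field_simp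
        ring
      have hlt : |t - t'| ≤ 1 :=
        abs_le.2 ⟨by linarith [ht.1, ht'.2], by linarith [ht.2, ht'.1]⟩
      have h2 := h _ (hmem j (by omega)) _ (hmem (j + 1) hj) (by
        rw [hsub, abs_mul, abs_of_pos (show (0 : ℝ) < 1 / (n + 1) by positivity)]
        exact (mul_le_of_le_one_left (by positivity) hlt).trans_lt hn) ω
      have h3 := abs_sub_le (F t ω) (F (t + ((j : ℝ) / (n + 1)) * (t' - t)) ω)
        (F (t + (((j + 1 : ℕ) : ℝ) / (n + 1)) * (t' - t)) ω)
      push_cast at *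
      linarith
  have := key (n + 1) le_rfl
  push_cast at this
  rwa [div_self hn0.ne', one_mul, add_sub_cancel] at this

/-- Two nearby points on the circle are nearby in `[0, 1)`, unless the second one lies just to the
right of `0`. -/
lemma abs_fract_sub_fract_lt {x y d : ℝ} (hxy : x < y) (hyd : y < x + d)
    (hd : d ≤ Int.fract y) : |Int.fract x - Int.fract y| < d := by
  have hfloor : ⌊x⌋ = ⌊y⌋ := by
    rw [Int.floor_eq_iff]
    constructor
    · linarith [Int.self_sub_floor y]
    · linarith [Int.lt_floor_add_one y]
  rw [Int.fract, Int.fract, hfloor, abs_lt]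
  constructor <;> linarith

theorem stmt2 {Ω : Type*} [MetricSpace Ω] [MeasurableSpace Ω] [BorelSpace Ω]
    (T : Ω → Ω) (μ : Measure Ω) [IsProbabilityMeasure μ]
    (hT : MeasurePreserving T μ μ) (hwm : WeakMixing T μ)
    (α : ℝ) (hα : Irrational α) (hα01 : α ∈ Set.Ico (0 : ℝ) 1)
    (F : ℝ → Ω → ℝ)
    (hInt : Integrable (fun p : ℝ × Ω => F p.1 p.2)
      ((volume.restrict (Set.Ico (0 : ℝ) 1)).prod μ))
    (hEqui : ∀ ε > 0, ∃ δ > 0, ∀ t ∈ Set.Ico (0 : ℝ) 1, ∀ t' ∈ Set.Ico (0 : ℝ) 1,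
      |t - t'| < δ → ∀ ω : Ω, |F t ω - F t' ω| < ε) :
    ∃ Ω' : Set Ω, μ Ω' = 1 ∧ ∀ ω ∈ Ω', ∀ t ∈ Set.Ico (0 : ℝ) 1,
      Tendsto (fun N : ℕ => (N : ℝ)⁻¹ *
          ∑ k ∈ Finset.Icc 1 N, F (Int.fract (t + k * α)) (T^[k] ω))
        atTop
        (𝓝 (∫ p, F p.1 p.2 ∂((volume.restrict (Set.Ico (0 : ℝ) 1)).prod μ))) := by
  obtain ⟨M, hM, hosc⟩ := exists_oscillation_bound hEqui
  have hprob : IsProbabilityMeasure (volume.restrict (Set.Ico (0 : ℝ) 1)) := ⟨by simp⟩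
  have hKint : ∀ n : ℕ, Integrable (fun p : ℝ × Ω =>
      (Set.Iio (1 / ((n : ℝ) + 1))).indicator (1 : ℝ → ℝ) p.1)
      ((volume.restrict (Set.Ico (0 : ℝ) 1)).prod μ) := fun n =>
    Integrable.comp_fst (f := (Set.Iio (1 / ((n : ℝ) + 1))).indicator (1 : ℝ → ℝ))
      ((integrable_const (1 : ℝ)).indicator measurableSet_Iio) μ
  have hKval : ∀ n : ℕ, ∫ p : ℝ × Ω, (Set.Iio (1 / ((n : ℝ) + 1))).indicator (1 : ℝ → ℝ) p.1
      ∂((volume.restrict (Set.Ico (0 : ℝ) 1)).prod μ) = 1 / ((n : ℝ) + 1) := by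
    intro n
    have hle : 1 / ((n : ℝ) + 1) ≤ 1 := by
      rw [div_le_one (by positivity)]
      linarith [n.cast_nonneg (α := ℝ)]
    have hset : Set.Iio (1 / ((n : ℝ) + 1)) ∩ Set.Ico (0 : ℝ) 1 =
        Set.Ico 0 (1 / ((n : ℝ) + 1)) := by
      ext x
      simp only [Set.mem_inter_iff, Set.mem_Iio, Set.mem_Ico]
      constructor
      · rintro ⟨h1, h2, -⟩; exact ⟨h2, h1⟩
      · rintro ⟨h1, h2⟩; exact ⟨h2, h1, h2.trans_le hle⟩
    rw [integral_fun_fst (f := (Set.Iio (1 / ((n : ℝ) + 1))).indicator (1 : ℝ → ℝ)),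
      integral_indicator_one measurableSet_Iio, measureReal_restrict_apply measurableSet_Iio,
      hset, Real.volume_real_Ico_of_le (by positivity)]
    simp
  have hae : ∀ᵐ ω ∂μ, ∀ t ∈ Set.Ico (0 : ℝ) 1,
      Tendsto (fun N : ℕ => (N : ℝ)⁻¹ *
          ∑ k ∈ Finset.Icc 1 N, F (Int.fract (t + k * α)) (T^[k] ω))
        atTop
        (𝓝 (∫ p, F p.1 p.2 ∂((volume.restrict (Set.Ico (0 : ℝ) 1)).prod μ))) := by
    filter_upwards [hwm.ae_ae_tendsto_average hT hα hInt,
      ae_all_iff.2 fun n : ℕ => hwm.ae_ae_tendsto_average hT hα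
        (K := fun t _ => (Set.Iio (1 / ((n : ℝ) + 1))).indicator (1 : ℝ → ℝ) t) (hKint n)]
      with ω hωF hωK t ht
    rw [Metric.tendsto_atTop']
    intro ε hε
    have hη : 0 < ε / 3 := by positivity
    obtain ⟨δ, hδ, hequi⟩ := hEqui (ε / 3) hη
    obtain ⟨n, hn⟩ := exists_nat_one_div_lt (lt_min hδ (div_pos hη hM))
    have hωK := hωK n
    simp only [hKval] at hωK
    set d : ℝ := 1 / ((n : ℝ) + 1) with hd
    have hd0 : 0 < d := by positivity
    have hdδ : d < δ := hn.trans_le (min_le_left _ _)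
    have hdM : d < ε / 3 / M := hn.trans_le (min_le_right _ _)
    obtain ⟨s, ⟨hsF, hsK⟩, hts, hsd⟩ : ∃ s, (_ ∧ _) ∧ t < s ∧ s < t + d := by
      have hlt : t < min (t + d) 1 := lt_min (by linarith) ht.2
      have hsub : Set.Ioo t (min (t + d) 1) ⊆ Set.Ico (0 : ℝ) 1 := fun x hx =>
        ⟨ht.1.trans hx.1.le, hx.2.trans_le (min_le_right _ _)⟩
      have hboth := ae_restrict_of_ae_restrict_of_subset hsub (hωF.and hωK)
      have hne : NeBot (ae (volume.restrict (Set.Ioo t (min (t + d) 1)))) := by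
        rw [ae_neBot, Ne, Measure.restrict_eq_zero, Real.volume_Ioo, ENNReal.ofReal_eq_zero]
        linarith
      obtain ⟨s, hs, hmem⟩ := (hboth.and (ae_restrict_mem measurableSet_Ioo)).exists
      exact ⟨s, hs, hmem.1, hmem.2.trans_le (min_le_left _ _)⟩
    have hterm : ∀ k : ℕ, |F (Int.fract (t + k * α)) (T^[k] ω) -
        F (Int.fract (s + k * α)) (T^[k] ω)| ≤
          ε / 3 + M * (Set.Iio d).indicator (1 : ℝ → ℝ) (Int.fract (s + k * α)) := by
      intro k
      have hfr : ∀ x : ℝ, Int.fract x ∈ Set.Ico (0 : ℝ) 1 :=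
        fun x => ⟨Int.fract_nonneg x, Int.fract_lt_one x⟩
      by_cases hk : Int.fract (s + k * α) < d
      · rw [Set.indicator_of_mem (Set.mem_Iio.2 hk), Pi.one_apply, mul_one]
        linarith [hosc _ (hfr (t + k * α)) _ (hfr (s + k * α)) (T^[k] ω)]
      · rw [Set.indicator_of_notMem (by simpa using hk), mul_zero, add_zero]
        refine (hequi _ (hfr _) _ (hfr _) (lt_trans ?_ hdδ) _).le
        exact abs_fract_sub_fract_lt (by linarith) (by linarith) (not_lt.1 hk)
    obtain ⟨N₁, hN₁⟩ := Metric.tendsto_atTop'.1 hsF (ε / 3) hη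
    obtain ⟨N₂, hN₂⟩ := eventually_atTop.1 (hsK.eventually_lt_const hdM)
    refine ⟨max N₁ N₂, fun N hN => ?_⟩
    have h1 := hN₁ N ((le_max_left _ _).trans_lt hN)
    have h2 := hN₂ N ((le_max_right _ _).trans hN.le)
    have hN0 : (0 : ℝ) < N := by exact_mod_cast (Nat.zero_le _).trans_lt hN
    have h3 : dist ((N : ℝ)⁻¹ * ∑ k ∈ Finset.Icc 1 N, F (Int.fract (t + k * α)) (T^[k] ω))
        ((N : ℝ)⁻¹ * ∑ k ∈ Finset.Icc 1 N, F (Int.fract (s + k * α)) (T^[k] ω)) ≤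
        ε / 3 + M * ((N : ℝ)⁻¹ * ∑ k ∈ Finset.Icc 1 N,
          (Set.Iio d).indicator (1 : ℝ → ℝ) (Int.fract (s + k * α))) := by
      rw [Real.dist_eq, ← mul_sub, abs_mul, abs_of_pos (inv_pos.2 hN0), ← Finset.sum_sub_distrib,
        inv_mul_le_iff₀ hN0]
      refine (Finset.abs_sum_le_sum_abs _ _).trans
        ((Finset.sum_le_sum fun k _ => hterm k).trans_eq ?_)
      rw [Finset.sum_add_distrib, ← Finset.mul_sum, Finset.sum_const, Nat.card_Icc,
        nsmul_eq_mul, Nat.add_sub_cancel,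
        mul_add, mul_left_comm (N : ℝ) M, mul_inv_cancel_left₀ hN0.ne']
    have h4 := (lt_div_iff₀' hM).1 h2
    linarith [dist_triangle
      ((N : ℝ)⁻¹ * ∑ k ∈ Finset.Icc 1 N, F (Int.fract (t + k * α)) (T^[k] ω))
      ((N : ℝ)⁻¹ * ∑ k ∈ Finset.Icc 1 N, F (Int.fract (s + k * α)) (T^[k] ω))
      (∫ p, F p.1 p.2 ∂((volume.restrict (Set.Ico (0 : ℝ) 1)).prod μ))]
  exact ⟨_, (measure_congr (eventuallyEq_univ.2 hae)).trans measure_univ, fun ω hω => hω⟩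
end

section
/- Let (Ω,μ,T) be a weak mixing probability measure-preserving system, let α ∈ (0,1) be irrational, let I ⊆ [0,1) be a finite union of intervals, and let F, G ∈ L^∞(Ω,μ). Let 𝒯_k be the σ-algebra generated by the functions F∘T^i and G∘T^i for all i ≥ k, and 𝒯 = ⋂_{k≥1} 𝒯_k. Fix versions of the conditional expectations E[F|𝒯] and E[G|𝒯]. Then for each t ∈ [0,1) there is a set Ω' ⊆ Ω of full μ-measure such that for all ω ∈ Ω': (1/N) ∑_{k=1}^N 𝟙_I({t+kα}) · [ F(T^{l_k(t)}ω) G(T^k ω) − E[F|𝒯](T^{l_k(t)}ω) E[G|𝒯](T^k ω) ] → 0 as N → ∞. -/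
open MeasureTheory Filter Topology

/-- `l_k(t) = ⌊t + α k⌋` (as a natural number). -/
noncomputable def lk (α t : ℝ) (k : ℕ) : ℕ := (⌊t + α * k⌋).toNat

/-- A finite union of (half-open) intervals in `ℝ`. -/
def IsFinUnionIntervals (I : Set ℝ) : Prop :=
  ∃ s : Finset (ℝ × ℝ), I = ⋃ p ∈ s, Set.Ico p.1 p.2

/-- The σ-algebra generated by the functions `F ∘ T^i` and `G ∘ T^i` for `i ≥ k`. -/
def tailAlg {Ω : Type*} (T : Ω → Ω) (F G : Ω → ℝ) (k : ℕ) : MeasurableSpace Ω :=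
  ⨆ i ∈ Set.Ici k,
    (MeasurableSpace.comap (F ∘ T^[i]) (inferInstance : MeasurableSpace ℝ) ⊔
      MeasurableSpace.comap (G ∘ T^[i]) (inferInstance : MeasurableSpace ℝ))

section

variable {Ω : Type*} [m0 : MeasurableSpace Ω]

/-- For a bounded sequence, convergence of the Cesàro means along the squares implies convergence
of all Cesàro means. -/
lemma tendsto_cesaro_zero_of_squares {a : ℕ → ℝ} {B : ℝ} (hB : ∀ k, |a k| ≤ B)
    (h : Tendsto (fun m : ℕ => ((m : ℝ) ^ 2)⁻¹ * ∑ k ∈ Finset.Icc 1 (m ^ 2), a k) atTop (𝓝 0)) :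
    Tendsto (fun N : ℕ => (N : ℝ)⁻¹ * ∑ k ∈ Finset.Icc 1 N, a k) atTop (𝓝 0) := by
  have hB0 : 0 ≤ B := (abs_nonneg _).trans (hB 0)
  have hsqrt : Tendsto Nat.sqrt atTop atTop := by
    refine tendsto_atTop.2 fun b => ?_
    filter_upwards [eventually_ge_atTop (b * b)] with n hn
    exact Nat.le_sqrt.2 hn
  have h1 : Tendsto (fun m : ℕ => |((m : ℝ) ^ 2)⁻¹ * ∑ k ∈ Finset.Icc 1 (m ^ 2), a k|
      + 2 * B * ((m : ℝ))⁻¹) atTop (𝓝 0) := by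
    simpa using h.abs.add (tendsto_inv_atTop_nhds_zero_nat (𝕜 := ℝ) |>.const_mul (2 * B))
  refine squeeze_zero_norm' ?_ (h1.comp hsqrt)
  filter_upwards [eventually_ge_atTop 1] with N hN
  simp only [Function.comp_apply, Real.norm_eq_abs]
  set m := Nat.sqrt N with hm
  have hm1 : 1 ≤ m := Nat.le_sqrt.2 (by simpa using hN)
  have hmN : m ^ 2 ≤ N := by rw [hm]; exact Nat.sqrt_le' N
  have hNm : N ≤ m ^ 2 + 2 * m := by
    have := Nat.sqrt_le_add N
    rw [← hm] at this
    nlinarith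
  have hsplit : ∑ k ∈ Finset.Icc 1 N, a k
      = ∑ k ∈ Finset.Icc 1 (m ^ 2), a k + ∑ k ∈ Finset.Ioc (m ^ 2) N, a k := by
    rw [← Finset.sum_union]
    · congr 1; ext k; simp only [Finset.mem_Icc, Finset.mem_union, Finset.mem_Ioc]; grind
    · rw [Finset.disjoint_left]; intro k; simp only [Finset.mem_Icc, Finset.mem_Ioc]; omega
  have htail : |∑ k ∈ Finset.Ioc (m ^ 2) N, a k| ≤ 2 * B * m := by
    calc |∑ k ∈ Finset.Ioc (m ^ 2) N, a k| ≤ ∑ k ∈ Finset.Ioc (m ^ 2) N, |a k| :=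
          Finset.abs_sum_le_sum_abs _ _
      _ ≤ ∑ _k ∈ Finset.Ioc (m ^ 2) N, B := Finset.sum_le_sum fun k _ => hB k
      _ = ((N - m ^ 2 : ℕ) : ℝ) * B := by simp
      _ ≤ ((2 * m : ℕ) : ℝ) * B := by
          gcongr; omega
      _ = 2 * B * m := by push_cast; ring
  have hmpos : (0 : ℝ) < m := by exact_mod_cast hm1
  have hNR : (m : ℝ) ^ 2 ≤ N := by exact_mod_cast hmN
  have hinv : (N : ℝ)⁻¹ ≤ ((m : ℝ) ^ 2)⁻¹ := inv_anti₀ (by positivity) hNR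
  rw [hsplit, abs_mul, abs_mul, abs_of_nonneg (by positivity : (0 : ℝ) ≤ (N : ℝ)⁻¹),
    abs_of_nonneg (by positivity : (0 : ℝ) ≤ ((m : ℝ) ^ 2)⁻¹)]
  calc (N : ℝ)⁻¹ * |∑ k ∈ Finset.Icc 1 (m ^ 2), a k + ∑ k ∈ Finset.Ioc (m ^ 2) N, a k|
      ≤ ((m : ℝ) ^ 2)⁻¹ * (|∑ k ∈ Finset.Icc 1 (m ^ 2), a k| + 2 * B * m) := by
        gcongr
        exact (abs_add_le _ _).trans (by gcongr)
    _ = _ := by field_simp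


/-- A strong law of large numbers for bounded random variables which are orthogonal whenever their
indices are large and at least `D` apart. -/
lemma ae_tendsto_cesaro_zero_of_orthogonal (μ : Measure Ω) [IsProbabilityMeasure μ]
    {X : ℕ → Ω → ℝ} (hXm : ∀ k, AEStronglyMeasurable (X k) μ) {B : ℝ}
    (hB : ∀ k, ∀ᵐ ω ∂μ, |X k ω| ≤ B) (D : ℕ)
    (hX : ∀ j k, D ≤ j → j + D ≤ k → ∫ ω, X j ω * X k ω ∂μ = 0) :
    ∀ᵐ ω ∂μ, Tendsto (fun N : ℕ => (N : ℝ)⁻¹ * ∑ k ∈ Finset.Icc 1 N, X k ω) atTop (𝓝 0) := by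
  have hB0 : 0 ≤ B := by
    obtain ⟨ω, hω⟩ := (hB 0).exists
    exact (abs_nonneg _).trans hω
  have hprod : ∀ j k, ∀ᵐ ω ∂μ, ‖X j ω * X k ω‖ ≤ B ^ 2 := by
    intro j k
    filter_upwards [hB j, hB k] with ω h1 h2
    rw [Real.norm_eq_abs, abs_mul, sq]
    gcongr
  have hprodint : ∀ j k, Integrable (fun ω => X j ω * X k ω) μ := fun j k =>
    Integrable.of_bound ((hXm j).mul (hXm k)) _ (hprod j k)
  have hle : ∀ j k, ∫ ω, X j ω * X k ω ∂μ ≤ B ^ 2 := by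
    intro j k
    refine (le_abs_self _).trans ?_
    simpa using norm_integral_le_of_norm_le_const (hprod j k)
  have hpair : ∀ j k, ∫ ω, X j ω * X k ω ∂μ ≤ B ^ 2 * ((if j ∈ Finset.range D then 1 else 0)
      + (if k ∈ Finset.range D then 1 else 0) + (if k ∈ Finset.Ico j (j + D) then 1 else 0)
      + (if j ∈ Finset.Ico k (k + D) then 1 else 0)) := by
    intro j k
    have h0 : (0 : ℝ) ≤ B ^ 2 := by positivity
    have hs : ∀ c d e f : Prop, ∀ [Decidable c] [Decidable d] [Decidable e] [Decidable f],
        (c ∨ d ∨ e ∨ f) → (1 : ℝ) ≤ (if c then 1 else 0) + (if d then 1 else 0)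
          + (if e then 1 else 0) + (if f then 1 else 0) := by
      intro c d e f _ _ _ _ h
      by_cases hc : c <;> by_cases hd : d <;> by_cases he : e <;> by_cases hf : f <;>
        first | (exfalso; tauto) | norm_num [hc, hd, he, hf]
    by_cases hcase : j ∈ Finset.range D ∨ k ∈ Finset.range D ∨ k ∈ Finset.Ico j (j + D)
        ∨ j ∈ Finset.Ico k (k + D)
    · exact (hle j k).trans (le_mul_of_one_le_right h0 (hs _ _ _ _ hcase))
    · have hz : ∫ ω, X j ω * X k ω ∂μ = 0 := by
        simp only [Finset.mem_range, Finset.mem_Ico, not_or, not_and, not_lt] at hcase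
        obtain ⟨h1, h2, h3, h4⟩ := hcase
        rcases le_total j k with hjk | hjk
        · exact hX j k h1 (h3 hjk)
        · simp_rw [mul_comm (X j _)]
          exact hX k j h2 (h4 hjk)
      rw [hz]
      positivity
  have hcard : ∀ (A S : Finset ℕ), ∑ k ∈ A, (if k ∈ S then (1 : ℝ) else 0) ≤ S.card := by
    intro A S
    rw [Finset.sum_ite_mem]
    simpa using Finset.card_le_card Finset.inter_subset_right
  have hexpand : ∀ (N : ℕ) (ω : Ω), (∑ k ∈ Finset.Icc 1 N, X k ω) ^ 2
      = ∑ j ∈ Finset.Icc 1 N, ∑ k ∈ Finset.Icc 1 N, X j ω * X k ω := fun N ω => by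
    rw [sq, Finset.sum_mul_sum]
  have hvar : ∀ N : ℕ, ∫ ω, (∑ k ∈ Finset.Icc 1 N, X k ω) ^ 2 ∂μ ≤ 4 * B ^ 2 * D * N := by
    intro N
    simp_rw [hexpand]
    rw [integral_finsetSum _ fun j _ => integrable_finsetSum _ fun k _ => hprodint j k]
    simp_rw [integral_finsetSum _ fun k _ => hprodint _ k]
    calc _ ≤ ∑ j ∈ Finset.Icc 1 N, ∑ k ∈ Finset.Icc 1 N,
          B ^ 2 * ((if j ∈ Finset.range D then 1 else 0)
      + (if k ∈ Finset.range D then 1 else 0) + (if k ∈ Finset.Ico j (j + D) then 1 else 0)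
      + (if j ∈ Finset.Ico k (k + D) then 1 else 0)) :=
          Finset.sum_le_sum fun j _ => Finset.sum_le_sum fun k _ => hpair j k
      _ = B ^ 2 * (∑ k ∈ Finset.Icc 1 N, ∑ j ∈ Finset.Icc 1 N,
              (if j ∈ Finset.range D then 1 else 0)
            + ∑ j ∈ Finset.Icc 1 N, ∑ k ∈ Finset.Icc 1 N, (if k ∈ Finset.range D then 1 else 0)
            + ∑ j ∈ Finset.Icc 1 N, ∑ k ∈ Finset.Icc 1 N,
              (if k ∈ Finset.Ico j (j + D) then 1 else 0)
            + ∑ k ∈ Finset.Icc 1 N, ∑ j ∈ Finset.Icc 1 N,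
              (if j ∈ Finset.Ico k (k + D) then 1 else 0)) := by
          simp_rw [← Finset.mul_sum, Finset.sum_add_distrib]
          congr 2
          · congr 2
            rw [Finset.sum_comm]
          · rw [Finset.sum_comm]
      _ ≤ B ^ 2 * (∑ k ∈ Finset.Icc 1 N, (D : ℝ) + ∑ k ∈ Finset.Icc 1 N, (D : ℝ)
            + ∑ k ∈ Finset.Icc 1 N, (D : ℝ) + ∑ k ∈ Finset.Icc 1 N, (D : ℝ)) := by
          gcongr
          · exact (hcard _ _).trans (by simp)
          · exact (hcard _ _).trans (by simp)
          · exact (hcard _ _).trans (by simp)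
          · exact (hcard _ _).trans (by simp)
      _ = 4 * B ^ 2 * D * N := by simp; ring
  have hS2 : ∀ N : ℕ, Integrable (fun ω => (∑ k ∈ Finset.Icc 1 N, X k ω) ^ 2) μ := by
    intro N
    simp_rw [hexpand]
    exact integrable_finsetSum _ fun j _ => integrable_finsetSum _ fun k _ => hprodint j k
  let Y : ℕ → Ω → ℝ := fun m ω => ((m : ℝ) ^ 2)⁻¹ * ∑ k ∈ Finset.Icc 1 (m ^ 2), X k ω
  have hY2 : ∀ m, Integrable (fun ω => Y m ω ^ 2) μ := by
    intro m
    simp_rw [Y, mul_pow]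
    exact (hS2 _).const_mul _
  have hYint : ∀ m, ∫ ω, Y m ω ^ 2 ∂μ ≤ 4 * B ^ 2 * D * ((m : ℝ) ^ 2)⁻¹ := by
    intro m
    simp_rw [Y, mul_pow]
    rw [integral_const_mul]
    rcases Nat.eq_zero_or_pos m with rfl | hm
    · simp
    calc _ ≤ (((m : ℝ) ^ 2)⁻¹) ^ 2 * (4 * B ^ 2 * D * ((m ^ 2 : ℕ) : ℝ)) := by
          gcongr; exact hvar _
      _ = _ := by push_cast; field_simp
  have hfin : ∫⁻ ω, ∑' m, ENNReal.ofReal (Y m ω ^ 2) ∂μ ≠ ⊤ := by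
    rw [lintegral_tsum fun m => (hY2 m).aestronglyMeasurable.aemeasurable.ennreal_ofReal]
    have hsum : Summable fun m : ℕ => 4 * B ^ 2 * D * ((m : ℝ) ^ 2)⁻¹ :=
      (Real.summable_nat_pow_inv.2 (by norm_num)).mul_left _
    refine ne_top_of_le_ne_top hsum.tsum_ofReal_ne_top (ENNReal.tsum_le_tsum fun m => ?_)
    rw [← ofReal_integral_eq_lintegral_ofReal (hY2 m) (ae_of_all _ fun ω => sq_nonneg _)]
    exact ENNReal.ofReal_le_ofReal (hYint m)
  have hae := ae_lt_top' (AEMeasurable.tsum fun m =>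
    (hY2 m).aestronglyMeasurable.aemeasurable.ennreal_ofReal) hfin
  filter_upwards [hae, ae_all_iff.2 hB] with ω hω hBω
  refine tendsto_cesaro_zero_of_squares hBω ?_
  have h1 := ENNReal.tendsto_atTop_zero_of_tsum_ne_top hω.ne
  have h2 := (ENNReal.tendsto_toReal ENNReal.zero_ne_top).comp h1
  have h3 : Tendsto (fun m => Y m ω ^ 2) atTop (𝓝 0) := by
    refine Tendsto.congr (fun m => ?_) h2
    simp [ENNReal.toReal_ofReal (sq_nonneg _)]
  have h4 := (Real.continuous_sqrt.tendsto 0).comp h3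
  rw [tendsto_zero_iff_abs_tendsto_zero]
  simpa only [Function.comp_def, Real.sqrt_sq_eq_abs, Real.sqrt_zero] using h4

/-- The maximal ergodic theorem (Hopf): the integral of `f` over the set where some Birkhoff sum of
length at most `N` is positive is nonnegative. -/
lemma maximal_ergodic {T : Ω → Ω} {μ : Measure Ω} (hT : MeasurePreserving T μ μ) {f : Ω → ℝ}
    (hfm : Measurable f) (hf : Integrable f μ) (N : ℕ) :
    0 ≤ ∫ ω in {ω | ∃ n ≤ N, 0 < birkhoffSum T f n ω}, f ω ∂μ := by
  let M : Ω → ℝ := fun ω => (Finset.range (N + 1)).sup' ⟨0, by simp⟩ fun n => birkhoffSum T f n ω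
  have hSm : ∀ n, Measurable (birkhoffSum T f n) := fun n => by
    unfold birkhoffSum
    exact Finset.measurable_sum _ fun k _ => hfm.comp (hT.measurable.iterate k)
  have hSi : ∀ n, Integrable (birkhoffSum T f n) μ := fun n => by
    unfold birkhoffSum
    exact integrable_finsetSum _ fun k _ =>
      ((hT.iterate k).integrable_comp hf.aestronglyMeasurable).2 hf
  have hle : ∀ n ≤ N, ∀ ω, birkhoffSum T f n ω ≤ M ω := fun n hn ω =>
    Finset.le_sup' (fun n => birkhoffSum T f n ω) (by simpa using Nat.lt_succ_of_le hn)
  have hM0 : ∀ ω, 0 ≤ M ω := fun ω => by simpa using hle 0 (Nat.zero_le _) ω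
  have hMm : Measurable M := by
    have : M = (Finset.range (N + 1)).sup' ⟨0, by simp⟩ (fun n => birkhoffSum T f n) := by
      ext ω; exact (Finset.sup'_apply _ _ _).symm
    rw [this]
    exact Finset.measurable_sup' _ fun n _ => hSm n
  have hMi : Integrable M μ := by
    refine Integrable.mono' (g := fun ω => ∑ n ∈ Finset.range (N + 1), |birkhoffSum T f n ω|)
      (integrable_finsetSum _ fun n _ => (hSi n).abs) hMm.aestronglyMeasurable
      (ae_of_all _ fun ω => ?_)
    rw [Real.norm_eq_abs, abs_of_nonneg (hM0 ω)]
    refine Finset.sup'_le _ _ fun n hn => (le_abs_self _).trans ?_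
    exact Finset.single_le_sum (f := fun n => |birkhoffSum T f n ω|) (fun i _ => abs_nonneg _) hn
  have hMTi : Integrable (fun ω => M (T ω)) μ := (hT.integrable_comp hMi.aestronglyMeasurable).2 hMi
  have hset : {ω | ∃ n ≤ N, 0 < birkhoffSum T f n ω} = {ω | 0 < M ω} := by
    ext ω
    change _ ↔ 0 < M ω
    refine Iff.trans ?_ (Finset.lt_sup'_iff _).symm
    simp
  have hms : MeasurableSet {ω | 0 < M ω} := measurableSet_lt measurable_const hMm
  have key : ∀ ω ∈ {ω | 0 < M ω}, M ω - M (T ω) ≤ f ω := by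
    intro ω hω
    have : M ω ≤ f ω + M (T ω) := by
      obtain ⟨n, hn, hMn⟩ := Finset.exists_mem_eq_sup' (s := Finset.range (N + 1)) ⟨0, by simp⟩
        (fun n => birkhoffSum T f n ω)
      change M ω = _ at hMn
      rw [hMn]
      cases n with
      | zero => simp [hMn] at hω
      | succ n =>
        rw [birkhoffSum_succ']
        gcongr
        refine hle n ?_ _
        simp at hn
        omega
    linarith
  rw [hset]
  calc (0 : ℝ) = ∫ ω, M ω ∂μ - ∫ ω, M (T ω) ∂μ := by
        have hmap := hT.map_eq
        have : ∫ ω, M (T ω) ∂μ = ∫ ω, M ω ∂μ := by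
          conv_rhs => rw [← hmap]
          rw [integral_map hT.aemeasurable (by rw [hmap]; exact hMi.aestronglyMeasurable)]
        rw [this, sub_self]
    _ ≤ ∫ ω in {ω | 0 < M ω}, M ω ∂μ - ∫ ω in {ω | 0 < M ω}, M (T ω) ∂μ := by
        have h1 : ∫ ω in {ω | 0 < M ω}, M ω ∂μ = ∫ ω, M ω ∂μ := by
          refine setIntegral_eq_integral_of_forall_compl_eq_zero fun ω hω => ?_
          exact le_antisymm (not_lt.1 hω) (hM0 ω)
        rw [h1]
        refine sub_le_sub_left (setIntegral_le_integral hMTi ?_) _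
        exact ae_of_all _ fun ω => hM0 _
    _ = ∫ ω in {ω | 0 < M ω}, (M ω - M (T ω)) ∂μ :=
        (integral_sub hMi.integrableOn hMTi.integrableOn).symm
    _ ≤ ∫ ω in {ω | 0 < M ω}, f ω ∂μ :=
        setIntegral_mono_on (hMi.sub hMTi).integrableOn hf.integrableOn hms key

/-- The weak-type maximal inequality for Birkhoff averages of a nonnegative function. -/
lemma mul_measureReal_birkhoffSum_gt_le {T : Ω → Ω} {μ : Measure Ω} [IsFiniteMeasure μ]
    (hT : MeasurePreserving T μ μ) {h : Ω → ℝ} (hm : Measurable h) (hi : Integrable h μ)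
    (h0 : ∀ ω, 0 ≤ h ω) (c : ℝ) :
    c * μ.real {ω | ∃ n : ℕ, c * n < birkhoffSum T h n ω} ≤ ∫ ω, h ω ∂μ := by
  have hsum : ∀ n ω, birkhoffSum T (fun ω => h ω - c) n ω = birkhoffSum T h n ω - c * n := by
    intro n ω
    simp [birkhoffSum, Finset.sum_sub_distrib, mul_comm]
  have hfin : ∀ N : ℕ, c * μ.real {ω | ∃ n ≤ N, c * n < birkhoffSum T h n ω} ≤ ∫ ω, h ω ∂μ := by
    intro N
    have h1 := maximal_ergodic hT (hm.sub_const c) (hi.sub (integrable_const c)) N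
    simp only [hsum, sub_pos] at h1
    rw [integral_sub hi.integrableOn (integrable_const c).integrableOn] at h1
    have h2 := setIntegral_le_integral (s := {ω | ∃ n ≤ N, c * n < birkhoffSum T h n ω}) hi
      (ae_of_all _ h0)
    simp at h1
    linarith [mul_comm c (μ.real {ω | ∃ n ≤ N, c * n < birkhoffSum T h n ω})]
  have hU : {ω | ∃ n : ℕ, c * n < birkhoffSum T h n ω}
      = ⋃ N : ℕ, {ω | ∃ n ≤ N, c * n < birkhoffSum T h n ω} := by
    ext ω
    simp only [Set.mem_ofPred_eq, Set.mem_iUnion]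
    exact ⟨fun ⟨n, hn⟩ => ⟨n, n, le_rfl, hn⟩, fun ⟨_, n, _, hn⟩ => ⟨n, hn⟩⟩
  have hmono : Monotone fun N : ℕ => {ω | ∃ n ≤ N, c * n < birkhoffSum T h n ω} :=
    fun N N' hN ω ⟨n, hn, h⟩ => ⟨n, hn.trans hN, h⟩
  have ht := tendsto_measure_iUnion_atTop (μ := μ) hmono
  rw [← hU] at ht
  have ht' := (ENNReal.tendsto_toReal (measure_ne_top _ _)).comp ht
  exact le_of_tendsto (ht'.const_mul c) (Eventually.of_forall hfin)

/-- A function which is a.e. equal to an `m n`-measurable function for all `n` is a.e. equal to a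
function measurable with respect to `⨅ n, m n`, if `m` is antitone. -/
lemma aestronglyMeasurable_iInf_of_antitone {μ : Measure Ω} {m : ℕ → MeasurableSpace Ω}
    (hm : Antitone m) {f : Ω → ℝ} (hf : ∀ n, AEStronglyMeasurable[m n] f μ) :
    AEStronglyMeasurable[⨅ n, m n] f μ := by
  choose g hg hfg using hf
  let L : Ω → EReal := fun ω => limsup (fun n => (g n ω : EReal)) atTop
  have hL : Measurable[⨅ n, m n] L := by
    intro s hs
    refine MeasurableSpace.measurableSet_iInf.2 fun N => ?_
    have : L = fun ω => limsup (fun n => (g (n + N) ω : EReal)) atTop := by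
      ext ω
      exact (limsup_nat_add (fun n => (g n ω : EReal)) N).symm
    have hLN : Measurable[m N] L := by
      rw [this]
      let _ := m N
      exact Measurable.limsup fun n => measurable_coe_real_ereal.comp
        (((hg (n + N)).mono (hm (Nat.le_add_left N n))).measurable)
    exact hLN hs
  refine ⟨fun ω => (L ω).toReal, ?_, ?_⟩
  · exact (measurable_ereal_toReal.comp hL).stronglyMeasurable
  · filter_upwards [ae_all_iff.2 hfg] with ω hω
    simp [L, ← hω]

/-- The downward theorem of Lévy in `L¹`, for square integrable functions. -/
lemma tendsto_integral_abs_condExp_sub_condExp_iInf {μ : Measure Ω} [IsProbabilityMeasure μ]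
    {m : ℕ → MeasurableSpace Ω} (hm : Antitone m) (hm0 : ∀ n, m n ≤ m0) {f : Ω → ℝ}
    (hf : MemLp f 2 μ) :
    Tendsto (fun n => ∫ ω, |(μ[f | m n]) ω - (μ[f | ⨅ n, m n]) ω| ∂μ) atTop (𝓝 0) := by
  have hi0 : ⨅ n, m n ≤ m0 := (iInf_le m 0).trans (hm0 0)
  have : ∀ n, Fact (m n ≤ m0) := fun n => ⟨hm0 n⟩
  have : Fact (⨅ n, m n ≤ m0) := ⟨hi0⟩
  let x : Lp ℝ 2 μ := hf.toLp
  let K : ℕ → Submodule ℝ (Lp ℝ 2 μ) := fun n => lpMeas ℝ ℝ (m n) 2 μ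
  let K' : Submodule ℝ (Lp ℝ 2 μ) := lpMeas ℝ ℝ (⨅ n, m n) 2 μ
  have : ∀ n, (K n).HasOrthogonalProjection := fun n => by dsimp only [K]; infer_instance
  have : K'.HasOrthogonalProjection := by dsimp only [K']; infer_instance
  have hK'K : ∀ n, K' ≤ K n := fun n g hg => mem_lpMeas_iff_aestronglyMeasurable.2
    ((mem_lpMeas_iff_aestronglyMeasurable.1 hg).mono (iInf_le m n))
  have hKanti : Antitone K := fun n n' h g hg => mem_lpMeas_iff_aestronglyMeasurable.2
    ((mem_lpMeas_iff_aestronglyMeasurable.1 hg).mono (hm h))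
  have ht := Submodule.starProjection_tendsto_closure_iSup (fun n => (K n)ᗮ)
    (fun n n' h => Submodule.orthogonal_le (hKanti h)) x
  set y := (⨆ n, (K n)ᗮ).topologicalClosure.starProjection x with hy
  have ht' : Tendsto (fun n => (K n).starProjection x) atTop (𝓝 (x - y)) := by
    refine (tendsto_const_nhds.sub ht).congr fun n => ?_
    rw [Submodule.starProjection_orthogonal_val]
    abel
  have hmem : x - y ∈ K' := by
    refine mem_lpMeas_iff_aestronglyMeasurable.2
      (aestronglyMeasurable_iInf_of_antitone hm fun N => ?_)
    rw [← mem_lpMeas_iff_aestronglyMeasurable (𝕜 := ℝ)]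
    have hcl : IsClosed (K N : Set (Lp ℝ 2 μ)) := by
      rw [← Submodule.orthogonal_orthogonal (K N)]
      exact Submodule.isClosed_orthogonal _
    refine hcl.mem_of_tendsto ht' ?_
    filter_upwards [eventually_ge_atTop N] with n hn
    exact hKanti hn (Submodule.starProjection_apply_mem _ _)
  have horth : x - (x - y) ∈ K'ᗮ := by
    rw [sub_sub_cancel]
    have : (⨆ n, (K n)ᗮ).topologicalClosure ≤ K'ᗮ :=
      Submodule.topologicalClosure_minimal _
        (iSup_le fun n => Submodule.orthogonal_le (hK'K n)) (Submodule.isClosed_orthogonal _)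
    exact this (Submodule.starProjection_apply_mem _ _)
  have hL : K'.starProjection x = x - y :=
    Submodule.eq_starProjection_of_mem_of_inner_eq_zero hmem fun w hw =>
      Submodule.inner_left_of_mem_orthogonal hw horth
  rw [← hL] at ht'
  rw [tendsto_iff_norm_sub_tendsto_zero] at ht'
  refine squeeze_zero (fun n => integral_nonneg fun ω => abs_nonneg _) (fun n => ?_) ht'
  have h1 : ((K n).starProjection x : Ω → ℝ) =ᵐ[μ] μ[f | m n] :=
    hf.condExpL2_ae_eq_condExp (𝕜 := ℝ) (hm0 n)
  have h2 : (K'.starProjection x : Ω → ℝ) =ᵐ[μ] μ[f | ⨅ n, m n] :=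
    hf.condExpL2_ae_eq_condExp (𝕜 := ℝ) hi0
  have h3 := (Lp.coeFn_sub ((K n).starProjection x) (K'.starProjection x))
  set z := (K n).starProjection x - K'.starProjection x
  calc ∫ ω, |(μ[f | m n]) ω - (μ[f | ⨅ n, m n]) ω| ∂μ = ∫ ω, ‖z ω‖ ∂μ := by
        refine integral_congr_ae ?_
        filter_upwards [h1, h2, h3] with ω e1 e2 e3
        rw [e3, Pi.sub_apply, e1, e2, Real.norm_eq_abs]
    _ = (eLpNorm z 1 μ).toReal := by
        rw [integral_norm_eq_lintegral_enorm (Lp.aestronglyMeasurable z),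
          eLpNorm_one_eq_lintegral_enorm]
    _ ≤ (eLpNorm z 2 μ).toReal := by
        refine ENNReal.toReal_mono (Lp.eLpNorm_ne_top z) ?_
        exact eLpNorm_le_eLpNorm_of_exponent_le (by norm_num) (Lp.aestronglyMeasurable z)
    _ = ‖z‖ := (Lp.norm_def z).symm

/-- If the integrals of nonnegative functions `h n` tend to zero, then almost surely some `h n` has
all its Birkhoff averages below a given level. -/
lemma ae_exists_birkhoffSum_le {T : Ω → Ω} {μ : Measure Ω} [IsFiniteMeasure μ]
    (hT : MeasurePreserving T μ μ) {h : ℕ → Ω → ℝ} (hm : ∀ n, Measurable (h n))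
    (hi : ∀ n, Integrable (h n) μ) (h0 : ∀ n ω, 0 ≤ h n ω)
    (hlim : Tendsto (fun n => ∫ ω, h n ω ∂μ) atTop (𝓝 0)) {c : ℝ} (hc : 0 < c) :
    ∀ᵐ ω ∂μ, ∃ n, ∀ N : ℕ, birkhoffSum T (h n) N ω ≤ c * N := by
  rw [ae_iff]
  have hle : ∀ n, μ.real {ω | ¬ ∃ n, ∀ N : ℕ, birkhoffSum T (h n) N ω ≤ c * N}
      ≤ c⁻¹ * ∫ ω, h n ω ∂μ := by
    intro n
    rw [le_inv_mul_iff₀ hc]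
    refine le_trans ?_ (mul_measureReal_birkhoffSum_gt_le hT (hm n) (hi n) (h0 n) c)
    refine mul_le_mul_of_nonneg_left (measureReal_mono fun ω hω => ?_) hc.le
    simp only [Set.mem_ofPred_eq, not_exists, not_forall, not_le] at hω ⊢
    exact hω n
  have h2 := ge_of_tendsto' (hlim.const_mul c⁻¹) hle
  rw [mul_zero] at h2
  exact (measureReal_eq_zero_iff).1 (le_antisymm h2 measureReal_nonneg)

/-- Summing a nonnegative sequence along a sequence of indices that takes every value at most `D`
times. -/
lemma sum_comp_le_of_gap {p : ℕ → ℕ} (hp : ∀ k, p k ≤ k) {D : ℕ}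
    (hD : ∀ j k, j + D ≤ k → p j + 1 ≤ p k) {a : ℕ → ℝ} (ha : ∀ k, 0 ≤ a k) (N : ℕ) :
    ∑ k ∈ Finset.Icc 1 N, a (p k) ≤ D * ∑ l ∈ Finset.range (N + 1), a l := by
  rw [← Finset.sum_fiberwise_of_maps_to (s := Finset.Icc 1 N) (t := Finset.range (N + 1)) (g := p)
    (fun k hk => by
      have := hp k
      simp only [Finset.mem_Icc, Finset.mem_range] at hk ⊢
      omega), Finset.mul_sum]
  refine Finset.sum_le_sum fun l _ => ?_
  have hcard : ((Finset.Icc 1 N).filter fun k => p k = l).card ≤ D := by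
    rcases ((Finset.Icc 1 N).filter fun k => p k = l).eq_empty_or_nonempty with he | hne
    · simp [he]
    · set S := (Finset.Icc 1 N).filter fun k => p k = l with hS
      have hsub : S ⊆ Finset.Ico (S.min' hne) (S.min' hne + D) := by
        intro k hk
        refine Finset.mem_Ico.2 ⟨S.min'_le k hk, ?_⟩
        by_contra! hcon
        have h1 := hD _ _ hcon
        have h2 := (Finset.mem_filter.1 (S.min'_mem hne)).2
        have h3 := (Finset.mem_filter.1 hk).2
        omega
      simpa using Finset.card_le_card hsub
  calc _ = ∑ k ∈ (Finset.Icc 1 N).filter fun k => p k = l, a l :=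
        Finset.sum_congr rfl fun k hk => by rw [(Finset.mem_filter.1 hk).2]
    _ ≤ D * a l := by
        rw [Finset.sum_const, nsmul_eq_mul]
        exact mul_le_mul_of_nonneg_right (by exact_mod_cast hcard) (ha l)

/-- The function `(U - E[U | m n]) ∘ T^p` is orthogonal to `m (n + p)`. -/
lemma integral_sub_condExp_comp_iterate_mul_eq_zero {T : Ω → Ω} {μ : Measure Ω}
    [IsProbabilityMeasure μ] (hT : MeasurePreserving T μ μ) {m : ℕ → MeasurableSpace Ω}
    (hm0 : ∀ n, m n ≤ m0) (hcomap : ∀ n l, (m n).comap T^[l] = m (n + l))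
    {U : Ω → ℝ} (hUi : Integrable U μ) (n p : ℕ) {W : Ω → ℝ} (hW : Measurable[m (n + p)] W)
    (hprodint : Integrable (fun ω => (U (T^[p] ω) - (μ[U | m n]) (T^[p] ω)) * W ω) μ) :
    ∫ ω, (U (T^[p] ω) - (μ[U | m n]) (T^[p] ω)) * W ω ∂μ = 0 := by
  rw [← hcomap] at hW
  obtain ⟨w, hw, rfl⟩ := Measurable.exists_eq_measurable_comp (mY := m n) hW
  have hTp := hT.iterate p
  have hw0 : Measurable w := hw.mono (hm0 n) le_rfl
  let v : Ω → ℝ := U - μ[U | m n]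
  have hvi : Integrable v μ := hUi.sub integrable_condExp
  have hvw : AEStronglyMeasurable (v * w) μ :=
    hvi.aestronglyMeasurable.mul hw0.aestronglyMeasurable
  have hprodint' : Integrable (v * w) μ := (hTp.integrable_comp hvw).1 hprodint
  have h1 : μ[v * w | m n] =ᵐ[μ] μ[v | m n] * w :=
    condExp_mul_of_stronglyMeasurable_right hw.stronglyMeasurable hprodint' hvi
  have h2 : μ[v | m n] =ᵐ[μ] 0 := by
    refine (condExp_sub hUi integrable_condExp (m n)).trans ?_
    rw [condExp_of_stronglyMeasurable (hm0 n) stronglyMeasurable_condExp integrable_condExp]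
    simp
  calc _ = ∫ ω, (v * w) (T^[p] ω) ∂μ := rfl
    _ = ∫ ω, (v * w) ω ∂μ := by
        conv_rhs => rw [← hTp.map_eq]
        rw [integral_map hTp.aemeasurable (by rw [hTp.map_eq]; exact hvw)]
    _ = ∫ ω, (μ[v * w | m n]) ω ∂μ := (integral_condExp (hm0 n)).symm
    _ = 0 := by
        refine integral_eq_zero_of_ae ?_
        filter_upwards [h1, h2] with ω e1 e2
        simp [e1, e2]

/-- Weighted averages of `(U - E[U | ⨅ n, m n]) ∘ T^(p k)` tend to zero almost everywhere, when the
weights are eventually measurable with respect to `m (p k + n)` for every `n`. -/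
lemma ae_tendsto_cesaro_sub_condExp_iInf {T : Ω → Ω} {μ : Measure Ω}
    [IsProbabilityMeasure μ] (hT : MeasurePreserving T μ μ) {m : ℕ → MeasurableSpace Ω}
    (hm : Antitone m) (hm0 : ∀ n, m n ≤ m0) (hcomap : ∀ n l, (m n).comap T^[l] = m (n + l))
    {U : Ω → ℝ} (hU : Measurable[m 0] U) {C : ℝ} (hC : ∀ ω, |U ω| ≤ C)
    {p : ℕ → ℕ} (hp : ∀ k, p k ≤ k) (hgap : ∀ n, ∃ D, ∀ j k, j + D ≤ k → p j + n ≤ p k)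
    {V : ℕ → Ω → ℝ} (hV : ∀ n, ∃ D, ∀ j, D ≤ j → Measurable[m (n + p j)] (V j))
    (hVm : ∀ j, Measurable (V j)) {B : ℝ} (hVB : ∀ j, ∀ᵐ ω ∂μ, |V j ω| ≤ B) :
    ∀ᵐ ω ∂μ, Tendsto (fun N : ℕ => (N : ℝ)⁻¹ * ∑ k ∈ Finset.Icc 1 N,
      (U (T^[p k] ω) - (μ[U | ⨅ n, m n]) (T^[p k] ω)) * V k ω) atTop (𝓝 0) := by
  have hi0 : ⨅ n, m n ≤ m0 := (iInf_le m 0).trans (hm0 0)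
  have hB0 : 0 ≤ B := by
    obtain ⟨ω, hω⟩ := (hVB 0).exists
    exact (abs_nonneg _).trans hω
  have hC0 : 0 ≤ C := by
    obtain ⟨ω, _⟩ := (hVB 0).exists
    exact (abs_nonneg _).trans (hC ω)
  have hU0 : Measurable U := hU.mono (hm0 0) le_rfl
  have hUL : MemLp U 2 μ :=
    MemLp.of_bound hU0.aestronglyMeasurable C (ae_of_all _ fun ω => by simpa using hC ω)
  have hUi : Integrable U μ := hUL.integrable (by norm_num)
  have hcomp : ∀ n l : ℕ, ∀ g : Ω → ℝ, Measurable[m n] g → Measurable[m (n + l)] (g ∘ T^[l]) := by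
    intro n l g hg
    rw [← hcomap]
    exact hg.comp (comap_measurable _)
  have hE : ∀ n, Measurable[m n] (μ[U | m n]) := fun n => stronglyMeasurable_condExp.measurable
  have hE0 : ∀ n, Measurable (μ[U | m n]) := fun n => (hE n).mono (hm0 n) le_rfl
  have hEi : Measurable (μ[U | ⨅ n, m n]) :=
    (stronglyMeasurable_condExp.measurable).mono hi0 le_rfl
  let X : ℕ → ℕ → Ω → ℝ := fun n k ω => (U (T^[p k] ω) - (μ[U | m n]) (T^[p k] ω)) * V k ω
  have hX0 : ∀ n k, Measurable (X n k) := fun n k =>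
    ((hU0.comp (hT.measurable.iterate _)).sub ((hE0 n).comp (hT.measurable.iterate _))).mul (hVm k)
  have hdiff : ∀ n k, ∀ᵐ ω ∂μ, |U (T^[p k] ω) - (μ[U | m n]) (T^[p k] ω)| ≤ 2 * C := by
    intro n k
    have h1 : ∀ᵐ ω ∂μ, |(μ[U | m n]) ω| ≤ C := ae_bdd_abs_condExp_of_ae_bdd_abs (ae_of_all _ hC)
    filter_upwards [(hT.iterate (p k)).quasiMeasurePreserving.ae h1] with ω hω
    have := abs_sub (U (T^[p k] ω)) ((μ[U | m n]) (T^[p k] ω))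
    linarith [hC (T^[p k] ω)]
  have hXB : ∀ n k, ∀ᵐ ω ∂μ, |X n k ω| ≤ 2 * C * B := by
    intro n k
    filter_upwards [hdiff n k, hVB k] with ω h1 h2
    rw [abs_mul]
    gcongr
  have hXlim : ∀ n, ∀ᵐ ω ∂μ,
      Tendsto (fun N : ℕ => (N : ℝ)⁻¹ * ∑ k ∈ Finset.Icc 1 N, X n k ω) atTop (𝓝 0) := by
    intro n
    obtain ⟨D1, hD1⟩ := hgap n
    obtain ⟨D2, hD2⟩ := hV n
    refine ae_tendsto_cesaro_zero_of_orthogonal μ (fun k => (hX0 n k).aestronglyMeasurable)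
      (hXB n) (max D1 D2) fun j k hj hjk => ?_
    have hpjk : n + p j ≤ p k := by
      have := hD1 j k (by omega)
      omega
    have hVj := hD2 j (by omega)
    have hVk := (hD2 k (by omega)).mono (hm (show n + p j ≤ n + p k by omega)) le_rfl
    have hUk : Measurable[m (n + p j)] (U ∘ T^[p k]) :=
      (hcomp 0 (p k) U hU).mono (hm (by omega)) le_rfl
    have hEk : Measurable[m (n + p j)] (μ[U | m n] ∘ T^[p k]) :=
      (hcomp n (p k) _ (hE n)).mono (hm (by omega)) le_rfl
    have hW : Measurable[m (n + p j)] (fun ω => V j ω * X n k ω) :=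
      hVj.mul ((hUk.sub hEk).mul hVk)
    have hXi : Integrable (fun ω => (U (T^[p j] ω) - (μ[U | m n]) (T^[p j] ω))
        * (V j ω * X n k ω)) μ := by
      have : Integrable (fun ω => X n j ω * X n k ω) μ := by
        refine Integrable.of_bound ((hX0 n j).mul (hX0 n k)).aestronglyMeasurable
          ((2 * C * B) * (2 * C * B)) ?_
        filter_upwards [hXB n j, hXB n k] with ω h1 h2
        rw [Real.norm_eq_abs, abs_mul]
        gcongr
      simpa only [X, mul_assoc] using this
    simpa only [X, mul_assoc] using
      integral_sub_condExp_comp_iterate_mul_eq_zero hT hm0 hcomap hUi n (p j) hW hXi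
  obtain ⟨D, hD⟩ := hgap 1
  let h : ℕ → Ω → ℝ := fun n ω => |(μ[U | m n]) ω - (μ[U | ⨅ n, m n]) ω|
  have hh0 : ∀ n ω, 0 ≤ h n ω := fun n ω => abs_nonneg _
  have hhae : ∀ᵐ ω ∂μ, ∀ q : ℕ, ∃ n, ∀ N : ℕ,
      birkhoffSum T (h n) N ω ≤ 1 / ((q : ℝ) + 1) * N := by
    refine ae_all_iff.2 fun q => ae_exists_birkhoffSum_le hT (fun n => ((hE0 n).sub hEi).abs)
      (fun n => (integrable_condExp.sub integrable_condExp).abs) hh0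
      (tendsto_integral_abs_condExp_sub_condExp_iInf hm hm0 hUL) (by positivity)
  filter_upwards [hhae, ae_all_iff.2 hXlim, ae_all_iff.2 hVB] with ω h1 h2 h3
  rw [Metric.tendsto_atTop]
  intro ε hε
  obtain ⟨q, hq⟩ := exists_nat_one_div_lt (show 0 < ε / 2 / (2 * B * D + 1) by positivity)
  rw [lt_div_iff₀ (by positivity)] at hq
  obtain ⟨n, hn⟩ := h1 q
  obtain ⟨N0, hN0⟩ := Metric.tendsto_atTop.1 (h2 n) (ε / 2) (by positivity)
  refine ⟨max N0 1, fun N hN => ?_⟩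
  have hN1 : 1 ≤ N := le_of_max_le_right hN
  have hNpos : (0 : ℝ) < N := by exact_mod_cast hN1
  have hb := hN0 N (le_of_max_le_left hN)
  rw [Real.dist_eq, sub_zero] at hb ⊢
  have hsplit : ∑ k ∈ Finset.Icc 1 N, (U (T^[p k] ω) - (μ[U | ⨅ n, m n]) (T^[p k] ω)) * V k ω
      = ∑ k ∈ Finset.Icc 1 N, X n k ω + ∑ k ∈ Finset.Icc 1 N,
        ((μ[U | m n]) (T^[p k] ω) - (μ[U | ⨅ n, m n]) (T^[p k] ω)) * V k ω := by
    rw [← Finset.sum_add_distrib]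
    refine Finset.sum_congr rfl fun k _ => ?_
    simp only [X]
    ring
  have herr : |∑ k ∈ Finset.Icc 1 N,
      ((μ[U | m n]) (T^[p k] ω) - (μ[U | ⨅ n, m n]) (T^[p k] ω)) * V k ω|
      ≤ 2 * B * D * (1 / ((q : ℝ) + 1)) * N := by
    calc _ ≤ ∑ k ∈ Finset.Icc 1 N, h n (T^[p k] ω) * B := by
          refine (Finset.abs_sum_le_sum_abs _ _).trans (Finset.sum_le_sum fun k _ => ?_)
          rw [abs_mul]
          exact mul_le_mul_of_nonneg_left (h3 k) (abs_nonneg _)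
      _ = B * ∑ k ∈ Finset.Icc 1 N, h n (T^[p k] ω) := by rw [← Finset.sum_mul, mul_comm]
      _ ≤ B * (D * ∑ l ∈ Finset.range (N + 1), h n (T^[l] ω)) := by
          refine mul_le_mul_of_nonneg_left ?_ hB0
          exact sum_comp_le_of_gap hp hD (a := fun l => h n (T^[l] ω)) (fun _ => hh0 _ _) N
      _ ≤ B * (D * (1 / ((q : ℝ) + 1) * (N + 1 : ℕ))) := by
          gcongr
          exact hn (N + 1)
      _ ≤ B * (D * (1 / ((q : ℝ) + 1) * (2 * N))) := by
          gcongr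
          push_cast
          have : (1 : ℝ) ≤ N := by exact_mod_cast hN1
          linarith
      _ = _ := by ring
  calc _ = |(N : ℝ)⁻¹ * ∑ k ∈ Finset.Icc 1 N, X n k ω + (N : ℝ)⁻¹ * ∑ k ∈ Finset.Icc 1 N,
        ((μ[U | m n]) (T^[p k] ω) - (μ[U | ⨅ n, m n]) (T^[p k] ω)) * V k ω| := by
        rw [hsplit, mul_add]
    _ ≤ |(N : ℝ)⁻¹ * ∑ k ∈ Finset.Icc 1 N, X n k ω| + (N : ℝ)⁻¹ * |∑ k ∈ Finset.Icc 1 N,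
        ((μ[U | m n]) (T^[p k] ω) - (μ[U | ⨅ n, m n]) (T^[p k] ω)) * V k ω| := by
        refine (abs_add_le _ _).trans (le_of_eq ?_)
        rw [abs_mul (N : ℝ)⁻¹ (∑ k ∈ Finset.Icc 1 N,
          ((μ[U | m n]) (T^[p k] ω) - (μ[U | ⨅ n, m n]) (T^[p k] ω)) * V k ω),
          abs_of_pos (inv_pos.2 hNpos)]
    _ < ε / 2 + (N : ℝ)⁻¹ * (2 * B * D * (1 / ((q : ℝ) + 1)) * N) :=
        add_lt_add_of_lt_of_le hb (mul_le_mul_of_nonneg_left herr (inv_pos.2 hNpos).le)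
    _ = ε / 2 + (1 / ((q : ℝ) + 1)) * (2 * B * D) := by field_simp
    _ ≤ ε := by
        have : 0 ≤ 1 / ((q : ℝ) + 1) := by positivity
        nlinarith

end

lemma tailAlg_antitone {Ω : Type*} (T : Ω → Ω) (F G : Ω → ℝ) : Antitone (tailAlg T F G) :=
  fun _ _ h => biSup_mono fun _ hi => le_trans h hi

lemma tailAlg_le {Ω : Type*} [m0 : MeasurableSpace Ω] {T : Ω → Ω} (hT : Measurable T)
    {F G : Ω → ℝ} (hF : Measurable F) (hG : Measurable G) (k : ℕ) : tailAlg T F G k ≤ m0 :=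
  iSup₂_le fun i _ => sup_le (hF.comp (hT.iterate i)).comap_le (hG.comp (hT.iterate i)).comap_le

lemma tailAlg_comap {Ω : Type*} (T : Ω → Ω) (F G : Ω → ℝ) (n l : ℕ) :
    (tailAlg T F G n).comap T^[l] = tailAlg T F G (n + l) := by
  have hterm : ∀ (H : Ω → ℝ) (i : ℕ),
      (MeasurableSpace.comap (H ∘ T^[i]) (inferInstance : MeasurableSpace ℝ)).comap T^[l]
        = MeasurableSpace.comap (H ∘ T^[i + l]) (inferInstance : MeasurableSpace ℝ) := by
    intro H i
    rw [MeasurableSpace.comap_comp, Function.comp_assoc, ← Function.iterate_add]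
  simp only [tailAlg, MeasurableSpace.comap_iSup, MeasurableSpace.comap_sup, hterm]
  apply le_antisymm
  · refine iSup₂_le fun i hi => ?_
    exact le_iSup₂_of_le (i + l) (Nat.add_le_add_right hi l) le_rfl
  · refine iSup₂_le fun i hi => ?_
    have hi' : n + l ≤ i := hi
    refine le_iSup₂_of_le (i - l) (show n ≤ i - l by omega) ?_
    rw [Nat.sub_add_cancel (by omega)]

lemma iInf_tailAlg {Ω : Type*} (T : Ω → Ω) (F G : Ω → ℝ) :
    ⨅ k ∈ Set.Ici 1, tailAlg T F G k = ⨅ k, tailAlg T F G k :=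
  le_antisymm (le_iInf fun k => (iInf₂_le (k + 1) (Nat.le_add_left 1 k)).trans
    (tailAlg_antitone T F G (Nat.le_succ k))) (le_iInf₂ fun k _ => iInf_le _ k)

lemma measurable_tailAlg_left {Ω : Type*} (T : Ω → Ω) (F G : Ω → ℝ) (i : ℕ) :
    Measurable[tailAlg T F G i] (F ∘ T^[i]) :=
  Measurable.of_comap_le (le_sup_left.trans (le_iSup₂_of_le i (le_refl i) le_rfl))

lemma measurable_tailAlg_right {Ω : Type*} (T : Ω → Ω) (F G : Ω → ℝ) (i : ℕ) :
    Measurable[tailAlg T F G i] (G ∘ T^[i]) :=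
  Measurable.of_comap_le (le_sup_right.trans (le_iSup₂_of_le i (le_refl i) le_rfl))

lemma cast_lk {α t : ℝ} (hα : 0 ≤ α) (ht : 0 ≤ t) (k : ℕ) : ((lk α t k : ℕ) : ℤ) = ⌊t + α * k⌋ :=
  Int.toNat_of_nonneg (Int.floor_nonneg.2 (by positivity))

lemma lk_le_add {α t : ℝ} (hα : 0 ≤ α) (ht : 0 ≤ t) (k : ℕ) : (lk α t k : ℝ) ≤ t + α * k := by
  have h : ((lk α t k : ℤ) : ℝ) ≤ t + α * k := by
    rw [cast_lk hα ht]
    exact Int.floor_le _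
  exact_mod_cast h

lemma lt_lk_add_one {α t : ℝ} (hα : 0 ≤ α) (ht : 0 ≤ t) (k : ℕ) :
    t + α * k < lk α t k + 1 := by
  have h : t + α * k < ((lk α t k : ℤ) : ℝ) + 1 := by
    rw [cast_lk hα ht]
    exact Int.lt_floor_add_one _
  exact_mod_cast h

lemma lk_le_self {α t : ℝ} (hα : α ∈ Set.Ioo (0 : ℝ) 1) (ht : t ∈ Set.Ico (0 : ℝ) 1) (k : ℕ) :
    lk α t k ≤ k := by
  have h1 := lk_le_add hα.1.le ht.1 k
  have h2 : α * k ≤ k := mul_le_of_le_one_left (Nat.cast_nonneg k) hα.2.le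
  have h3 : (lk α t k : ℝ) < k + 1 := by linarith [ht.2]
  exact Nat.lt_succ_iff.1 (by exact_mod_cast h3)

lemma exists_lk_gap {α t : ℝ} (hα : 0 < α) (ht : 0 ≤ t) (n : ℕ) :
    ∃ D, ∀ j k, j + D ≤ k → lk α t j + n ≤ lk α t k := by
  obtain ⟨D, hD⟩ := exists_nat_ge (((n : ℝ) + 1) / α)
  rw [div_le_iff₀ hα] at hD
  refine ⟨D, fun j k hjk => ?_⟩
  have h1 := lk_le_add hα.le ht j
  have h2 := lt_lk_add_one hα.le ht k
  have h3 : (j : ℝ) + D ≤ k := by exact_mod_cast hjk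
  have h4 : α * (j + D) ≤ α * k := mul_le_mul_of_nonneg_left h3 hα.le
  have h5 : ((lk α t j + n : ℕ) : ℝ) < ((lk α t k : ℕ) : ℝ) := by push_cast; nlinarith
  exact_mod_cast h5.le

lemma exists_add_lk_le {α t : ℝ} (hα : α ∈ Set.Ioo (0 : ℝ) 1) (ht : t ∈ Set.Ico (0 : ℝ) 1)
    (n : ℕ) : ∃ D, ∀ j, D ≤ j → n + lk α t j ≤ j := by
  have hα1 : 0 < 1 - α := sub_pos.2 hα.2
  obtain ⟨D, hD⟩ := exists_nat_ge (((n : ℝ) + 1) / (1 - α))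
  rw [div_le_iff₀ hα1] at hD
  refine ⟨D, fun j hj => ?_⟩
  have h1 := lk_le_add hα.1.le ht.1 j
  have h3 : (D : ℝ) ≤ j := by exact_mod_cast hj
  have h4 : D * (1 - α) ≤ j * (1 - α) := mul_le_mul_of_nonneg_right h3 hα1.le
  have h5 : ((n + lk α t j : ℕ) : ℝ) ≤ (j : ℝ) := by push_cast; nlinarith [ht.2]
  exact_mod_cast h5

theorem stmt5 {Ω : Type*} [MeasurableSpace Ω]
    (T : Ω → Ω) (μ : Measure Ω) [IsProbabilityMeasure μ]
    (hT : MeasurePreserving T μ μ) (hwm : WeakMixing T μ)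
    (α : ℝ) (hα : Irrational α) (hα01 : α ∈ Set.Ioo (0 : ℝ) 1)
    (I : Set ℝ) (hI : IsFinUnionIntervals I) (hI01 : I ⊆ Set.Ico (0 : ℝ) 1)
    (F G : Ω → ℝ) (hFmeas : Measurable F) (hGmeas : Measurable G)
    (hFbd : ∃ C : ℝ, ∀ ω, |F ω| ≤ C) (hGbd : ∃ C : ℝ, ∀ ω, |G ω| ≤ C) :
    ∀ t ∈ Set.Ico (0 : ℝ) 1,
      ∃ Ω' : Set Ω, μ Ω' = 1 ∧ ∀ ω ∈ Ω',
        Tendsto (fun N : ℕ => (N : ℝ)⁻¹ *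
            ∑ k ∈ Finset.Icc 1 N,
              Set.indicator I (1 : ℝ → ℝ) (Int.fract (t + k * α)) *
                (F (T^[lk α t k] ω) * G (T^[k] ω) -
                  (μ[F | ⨅ k ∈ Set.Ici 1, tailAlg T F G k]) (T^[lk α t k] ω) *
                    (μ[G | ⨅ k ∈ Set.Ici 1, tailAlg T F G k]) (T^[k] ω)))
          atTop (𝓝 0) := by
  intro t ht
  rw [iInf_tailAlg]
  obtain ⟨CF, hCF⟩ := hFbd
  obtain ⟨CG, hCG⟩ := hGbd
  have hTm := hT.measurable
  have hm := tailAlg_antitone T F G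
  have hm0 := tailAlg_le hTm hFmeas hGmeas
  have hcomap := tailAlg_comap T F G
  have hi0 : ⨅ k, tailAlg T F G k ≤ _ := (iInf_le _ 0).trans (hm0 0)
  let c : ℕ → ℝ := fun k => Set.indicator I (1 : ℝ → ℝ) (Int.fract (t + k * α))
  have hc : ∀ k, |c k| ≤ 1 := by
    intro k
    by_cases h : Int.fract (t + k * α) ∈ I <;> simp [c, h]
  have hF1 : Measurable[⨅ k, tailAlg T F G k] (μ[F | ⨅ k, tailAlg T F G k]) :=
    stronglyMeasurable_condExp.measurable
  have hleft := ae_tendsto_cesaro_sub_condExp_iInf hT hm hm0 hcomap (U := F)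
    (measurable_tailAlg_left T F G 0) hCF (p := lk α t) (lk_le_self hα01 ht)
    (exists_lk_gap hα01.1 ht.1) (V := fun k ω => c k * G (T^[k] ω))
    (fun n => by
      obtain ⟨D, hD⟩ := exists_add_lk_le hα01 ht n
      exact ⟨D, fun j hj =>
        ((measurable_tailAlg_right T F G j).mono (hm (hD j hj)) le_rfl).const_mul (c j)⟩)
    (fun j => (hGmeas.comp (hTm.iterate j)).const_mul (c j)) (B := CG)
    (fun j => ae_of_all _ fun ω => by
      rw [abs_mul]
      exact (mul_le_of_le_one_left (abs_nonneg _) (hc j)).trans (hCG _))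
  have hright := ae_tendsto_cesaro_sub_condExp_iInf hT hm hm0 hcomap (U := G)
    (measurable_tailAlg_right T F G 0) hCG (p := fun k => k) (fun _ => le_rfl)
    (fun n => ⟨n, fun _ _ h => h⟩)
    (V := fun k ω => c k * (μ[F | ⨅ k, tailAlg T F G k]) (T^[lk α t k] ω))
    (fun n => ⟨0, fun j _ => by
      have h1 : Measurable[tailAlg T F G (n + j + lk α t j)]
          (μ[F | ⨅ k, tailAlg T F G k] ∘ T^[lk α t j]) := by
        rw [← hcomap]
        exact (hF1.mono (iInf_le _ _) le_rfl).comp (comap_measurable _)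
      exact (h1.mono (hm (Nat.le_add_right _ _)) le_rfl).const_mul (c j)⟩)
    (fun j => ((hF1.mono hi0 le_rfl).comp (hTm.iterate _)).const_mul (c j)) (B := CF)
    (fun j => by
      have h1 : ∀ᵐ ω ∂μ, |(μ[F | ⨅ k, tailAlg T F G k]) ω| ≤ CF :=
        ae_bdd_abs_condExp_of_ae_bdd_abs (ae_of_all _ hCF)
      filter_upwards [(hT.iterate (lk α t j)).quasiMeasurePreserving.ae h1] with ω hω
      rw [abs_mul]
      exact (mul_le_of_le_one_left (abs_nonneg _) (hc j)).trans hω)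
  refine ⟨_, (measure_congr (eventuallyEq_univ.2 (hleft.and hright))).trans measure_univ,
    fun ω hω => ?_⟩
  have hsum := hω.1.add hω.2
  rw [add_zero] at hsum
  refine hsum.congr fun N => ?_
  rw [← mul_add, ← Finset.sum_add_distrib]
  congr 1
  refine Finset.sum_congr rfl fun k _ => ?_
  simp only [c]
  ring
end
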